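/- Suppose a⁰,a¹ : ℕ → ℂ² satisfy condition (A), conditions (C1)–(C5), and ‖a⁰₀‖ < 1. Then at least one of the following four alternatives holds. [Type 2] There exist orthonormal vectors u₀,u₁ ∈ ℂ² such that a⁰₁ = u₀, a⁰_k = 0 for all k ≠ 1, a¹₀ = u₁ and a¹_k = 0 for all k ≥ 1. [Type 3] There exist an orthonormal basis u₀,u₁ of ℂ², 0 < ρ < 1 and θ ∈ ℝ such that a⁰₀ = ρ·u₀, a⁰₁ = √(1−ρ²)·u₁, a⁰_k = 0 for k ≥ 2, a¹₀ = e^{iθ}√(1−ρ²)·u₀, a¹₁ = −e^{iθ}ρ·u₁ and a¹_k = 0 for k ≥ 2. [Type 4] There exist an orthonormal basis u₀,u₁ of ℂ², 0 < ρ < 1 and θ ∈ ℝ such that a⁰₀ = ρ·u₀, a⁰_k = (1−ρ²)·e^{iθ}·(−ρe^{iθ})^{k−1}·u₀ for all k ≥ 1, a¹₀ = u₁ and a¹_k = 0 for all k ≥ 1. [Type 5] There exist unit vectors u₀,u₁,v ∈ ℂ² with ⟨v,u₀⟩ ≠ 0, nonzero complex numbers ρ₀,ρ₁,τ₀,τ₁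 and r ∈ ℂ such that 0 < |ρ₀| < 1, (|ρ₀|²/(1−|ρ₀|²))·⟨u₀,u₁⟩·⟨v,u₀⟩ + ⟨v,u₁⟩ = 0, r = −(conj(ρ₀)/conj(ρ₁))·⟨v,u₀⟩/(1 + (|ρ₀|²/(1−|ρ₀|²))·|⟨v,u₀⟩|²), |ρ₁|² = (1−|ρ₀|²)/(1 + (|ρ₀|²/(1−|ρ₀|²))·|⟨v,u₀⟩|²), |τ₀|² = 1/(1 + (|ρ₀|²/(1−|ρ₀|²))·|⟨u₁,u₀⟩|²), τ₁ = τ₀·ρ₁·⟨u₁,v⟩/(ρ₀·⟨u₀,v⟩), and a⁰₀ = ρ₀·u₀, a⁰_k = ρ₁·r^{k−1}·v for k ≥ 1, a¹₀ = τ₀·u₁, a¹_k = τ₁·r^{k−1}·v for k ≥ 1. -/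

import Mathlib

open Finset

/-- `ℂ²` with its Euclidean structure. -/
abbrev E2 := EuclideanSpace ℂ (Fin 2)

/-- The inner product of `ℂ²`: `⟨u,v⟩ = u⁽¹⁾conj(v⁽¹⁾) + u⁽²⁾conj(v⁽²⁾)`. -/
noncomputable def cinner (u v : E2) : ℂ := ∑ i, u i * (starRingEnd ℂ) (v i)

/-- Condition (A). -/
def condA (a0 a1 : ℕ → E2) : Prop :=
  (∀ m : ℕ, (∑' k : ℕ, cinner (a0 (k + m)) (a0 k)) = if m = 0 then 1 else 0) ∧
  (∀ m : ℕ, (∑' k : ℕ, cinner (a1 (k + m)) (a1 k)) = if m = 0 then 1 else 0) ∧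
  (∀ m : ℕ, (∑' k : ℕ, cinner (a0 (k + m)) (a1 k)) = 0) ∧
  (∀ m : ℕ, (∑' k : ℕ, cinner (a1 (k + m)) (a0 k)) = 0)

/-- Conditions (C1)–(C5), with `d := 1 − ‖a0 0‖²`. -/
def condC (a0 a1 : ℕ → E2) : Prop :=
  (∀ p : ℕ, 1 ≤ p → ‖cinner (a0 p) (a0 0)‖ ^ 2
      = (1 - ‖a0 0‖ ^ 2) * (1 - ∑ k ∈ Finset.range (p + 1), ‖a0 k‖ ^ 2)) ∧
  (∀ p : ℕ, ‖cinner (a1 p) (a0 0)‖ ^ 2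
      = (1 - ‖a0 0‖ ^ 2) * (1 - ∑ k ∈ Finset.range (p + 1), ‖a1 k‖ ^ 2)) ∧
  (∀ p p' : ℕ, 0 < p → p < p' →
    cinner (a0 p') (a0 0) * cinner (a0 0) (a0 p)
      = -((1 - ‖a0 0‖ ^ 2 : ℝ) : ℂ) *
          ∑ r ∈ Finset.range (p + 1), cinner (a0 (p' - r)) (a0 (p - r))) ∧
  (∀ p p' : ℕ, p < p' →
    cinner (a1 p') (a0 0) * cinner (a0 0) (a1 p)
      = -((1 - ‖a0 0‖ ^ 2 : ℝ) : ℂ) *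
          ∑ r ∈ Finset.range (p + 1), cinner (a1 (p' - r)) (a1 (p - r))) ∧
  (∀ p p' : ℕ, 0 < p → p ≤ p' →
    cinner (a1 p') (a0 0) * cinner (a0 0) (a0 p)
      = -((1 - ‖a0 0‖ ^ 2 : ℝ) : ℂ) *
          ∑ r ∈ Finset.range (p + 1), cinner (a1 (p' - r)) (a0 (p - r))) ∧
  (∀ p p' : ℕ, p' < p →
    cinner (a1 p') (a0 0) * cinner (a0 0) (a0 p)
      = -((1 - ‖a0 0‖ ^ 2 : ℝ) : ℂ) *
          ∑ r ∈ Finset.range (p' + 1), cinner (a1 (p' - r)) (a0 (p - r)))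

open ComplexConjugate

theorem cinner_eq_inner (u v : E2) : cinner u v = inner ℂ v u := by
  simp [cinner, PiLp.inner_apply]

theorem cinner_smul_left (c : ℂ) (u v : E2) : cinner (c • u) v = c * cinner u v := by
  rw [cinner_eq_inner, cinner_eq_inner, inner_smul_right]

theorem cinner_smul_right (c : ℂ) (u v : E2) : cinner u (c • v) = conj c * cinner u v := by
  rw [cinner_eq_inner, cinner_eq_inner, inner_smul_left]

theorem cinner_sub_left (u v w : E2) : cinner (u - v) w = cinner u w - cinner v w := by
  simp only [cinner_eq_inner, inner_sub_right]

theorem cinner_sub_right (u v w : E2) : cinner u (v - w) = cinner u v - cinner u w := by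
  simp only [cinner_eq_inner, inner_sub_left]

theorem conj_cinner (u v : E2) : conj (cinner u v) = cinner v u := by
  simp only [cinner_eq_inner, inner_conj_symm]

theorem cinner_self (u : E2) : cinner u u = ((‖u‖ ^ 2 : ℝ) : ℂ) := by
  rw [cinner_eq_inner, inner_self_eq_norm_sq_to_K]
  simp

/-- The equality case of Cauchy–Schwarz for the positive definite form
`(u, v) ↦ d⟨u,v⟩ + ⟨u,w⟩⟨w,v⟩`, against a vector `e` of length one. -/
theorem eq_smul_of_form_eq {d : ℝ} (hd : 0 < d) {w e x : E2} {c : ℂ}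
    (hee : d * cinner e e + cinner e w * cinner w e = 1)
    (hxe : d * cinner x e + cinner x w * cinner w e = c)
    (hxx : d * cinner x x + cinner x w * cinner w x = c * conj c) : x = c • e := by
  have hex : d * cinner e x + cinner e w * cinner w x = conj c := by
    rw [← hxe]
    simp only [map_add, map_mul, conj_cinner, Complex.conj_ofReal]
    ring
  have key : (d : ℂ) * cinner (x - c • e) (x - c • e)
      + cinner (x - c • e) w * conj (cinner (x - c • e) w) = 0 := by
    rw [conj_cinner]
    simp only [cinner_sub_left, cinner_sub_right, cinner_smul_left, cinner_smul_right]
    linear_combination hxx - conj c * hxe - c * hex + c * conj c * hee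
  rw [cinner_self, Complex.mul_conj, Complex.normSq_eq_norm_sq] at key
  have key' : d * ‖x - c • e‖ ^ 2 + ‖cinner (x - c • e) w‖ ^ 2 = 0 := by exact_mod_cast key
  have hx : ‖x - c • e‖ ^ 2 = 0 := by
    nlinarith [sq_nonneg ‖cinner (x - c • e) w‖, sq_nonneg ‖x - c • e‖]
  exact sub_eq_zero.mp (norm_eq_zero.mp (pow_eq_zero_iff two_ne_zero |>.mp hx))

/-- In `ℂ²`, two vectors orthogonal to a common nonzero vector are proportional. -/
theorem exists_eq_smul_of_cinner_eq_zero {b w e : E2} (he : e ≠ 0) (hw : w ≠ 0)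
    (hbe : cinner b e = 0) (hwe : cinner w e = 0) : ∃ c : ℂ, b = c • w := by
  simp only [cinner, Fin.sum_univ_two] at hbe hwe
  have hdet : b 0 * w 1 = b 1 * w 0 := by
    by_contra hne
    have hne' : b 0 * w 1 - b 1 * w 0 ≠ 0 := sub_ne_zero.mpr hne
    have h0 : conj (e 0) = 0 := by
      refine (mul_eq_zero.mp ?_).resolve_left hne'
      linear_combination w 1 * hbe - b 1 * hwe
    have h1 : conj (e 1) = 0 := by
      refine (mul_eq_zero.mp ?_).resolve_left hne'
      linear_combination b 0 * hwe - w 0 * hbe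
    refine he (PiLp.ext fun i => ?_)
    fin_cases i
    · simpa using h0
    · simpa using h1
  by_cases hw0 : w 0 = 0
  · have hw1 : w 1 ≠ 0 := fun hw1 => hw (PiLp.ext fun i => by fin_cases i <;> simpa)
    have hb0 : b 0 = 0 := by simpa [hw0, hw1] using hdet
    refine ⟨b 1 / w 1, PiLp.ext fun i => ?_⟩
    fin_cases i
    · simp [hw0, hb0]
    · simp [hw1]
  · refine ⟨b 0 / w 0, PiLp.ext fun i => ?_⟩
    fin_cases i
    · simp [hw0]
    · simp only [Fin.mk_one, PiLp.smul_apply, smul_eq_mul]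
      field_simp
      linear_combination -hdet

theorem norm_inv_norm_smul {x : E2} (hx : x ≠ 0) : ‖((‖x‖ : ℂ))⁻¹ • x‖ = 1 := by
  rw [norm_smul, norm_inv, Complex.norm_real, norm_norm,
    inv_mul_cancel₀ (norm_ne_zero_iff.mpr hx)]

theorem norm_smul_inv_norm_smul {x : E2} (hx : x ≠ 0) : (‖x‖ : ℂ) • ((‖x‖ : ℂ))⁻¹ • x = x := by
  rw [smul_smul, mul_inv_cancel₀ (by exact_mod_cast norm_ne_zero_iff.mpr hx), one_smul]

/-- Conditions (C1)–(C5) force both sequences to be geometric, with common ratio `⟨e,a⁰₀⟩` and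
common direction `e`, from index one on. -/
theorem condC.exists_geometric {a0 a1 : ℕ → E2} (hC : condC a0 a1) (h00 : ‖a0 0‖ < 1) :
    ∃ e : E2,
      (1 - ‖a0 0‖ ^ 2) * ‖e‖ ^ 2 + ‖cinner e (a0 0)‖ ^ 2 = 1 ∧
      (1 - ‖a0 0‖ ^ 2) * ‖a1 0‖ ^ 2 + ‖cinner (a1 0) (a0 0)‖ ^ 2 = 1 - ‖a0 0‖ ^ 2 ∧
      ((1 - ‖a0 0‖ ^ 2 : ℝ) : ℂ) * cinner (a1 0) e
        + cinner (a1 0) (a0 0) * cinner (a0 0) e = 0 ∧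
      (∀ k, a0 (k + 1) =
        (-((1 - ‖a0 0‖ ^ 2 : ℝ) : ℂ) * cinner e (a0 0) ^ k) • e) ∧
      (∀ k, a1 (k + 1) = (cinner (a1 0) (a0 0) * cinner e (a0 0) ^ k) • e) := by
  obtain ⟨h1, h2, h3, -, h5, h6⟩ := hC
  have hd : 0 < 1 - ‖a0 0‖ ^ 2 := by nlinarith [norm_nonneg (a0 0)]
  generalize hdd : 1 - ‖a0 0‖ ^ 2 = d at *
  have hdC : (d : ℂ) ≠ 0 := by exact_mod_cast hd.ne'
  -- one-step consequences of the hypotheses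
  have form_self (x : E2) (t : ℝ) (h : ‖cinner x (a0 0)‖ ^ 2 = t - d * ‖x‖ ^ 2) :
      d * cinner x x + cinner x (a0 0) * cinner (a0 0) x = t := by
    rw [← conj_cinner x (a0 0), cinner_self, Complex.mul_conj, Complex.normSq_eq_norm_sq]
    rw [h]; push_cast; ring
  have h11 : d * cinner (a0 1) (a0 1) + cinner (a0 1) (a0 0) * cinner (a0 0) (a0 1)
      = ((d ^ 2 : ℝ) : ℂ) := by
    apply form_self
    rw [h1 1 le_rfl, Finset.sum_range_succ, Finset.sum_range_one]
    linear_combination d * hdd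
  have h0self (p : ℕ) : d * cinner (a0 (p + 2)) (a0 (p + 2))
      + cinner (a0 (p + 2)) (a0 0) * cinner (a0 0) (a0 (p + 2))
      = ((‖cinner (a0 (p + 1)) (a0 0)‖ ^ 2 : ℝ) : ℂ) := by
    apply form_self
    rw [h1 (p + 2) (by omega), h1 (p + 1) (by omega), Finset.sum_range_succ _ (p + 2)]
    ring
  have h1self (p : ℕ) : d * cinner (a1 (p + 1)) (a1 (p + 1))
      + cinner (a1 (p + 1)) (a0 0) * cinner (a0 0) (a1 (p + 1))
      = ((‖cinner (a1 p) (a0 0)‖ ^ 2 : ℝ) : ℂ) := by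
    apply form_self
    rw [h2 (p + 1), h2 p, Finset.sum_range_succ _ (p + 1)]
    ring
  have h01 (p : ℕ) : d * cinner (a0 (p + 2)) (a0 1)
      + cinner (a0 (p + 2)) (a0 0) * cinner (a0 0) (a0 1)
      = -d * cinner (a0 (p + 1)) (a0 0) := by
    have := h3 1 (p + 2) one_pos (by omega)
    rw [Finset.sum_range_succ, Finset.sum_range_one] at this
    simp only [Nat.sub_zero, Nat.sub_self, show p + 2 - 1 = p + 1 from rfl] at this
    linear_combination this
  have h10 (p : ℕ) : d * cinner (a1 (p + 1)) (a0 1)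
      + cinner (a1 (p + 1)) (a0 0) * cinner (a0 0) (a0 1)
      = -d * cinner (a1 p) (a0 0) := by
    have := h5 1 (p + 1) one_pos (by omega)
    rw [Finset.sum_range_succ, Finset.sum_range_one] at this
    simp only [Nat.sub_zero, Nat.sub_self, Nat.add_sub_cancel] at this
    linear_combination this
  have hb0 : d * cinner (a1 0) (a0 1) + cinner (a1 0) (a0 0) * cinner (a0 0) (a0 1) = 0 := by
    have := h6 1 0 one_pos
    rw [zero_add, Finset.sum_range_one] at this
    simp only [Nat.sub_zero] at this
    linear_combination this
  have hbb := h2 0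
  rw [zero_add, Finset.sum_range_one] at hbb
  obtain ⟨e, he⟩ : ∃ e : E2, a0 1 = (-d : ℂ) • e :=
    ⟨(-d : ℂ)⁻¹ • a0 1, by rw [smul_smul, mul_inv_cancel₀ (neg_ne_zero.mpr hdC), one_smul]⟩
  simp only [he, cinner_smul_left, cinner_smul_right, map_neg, Complex.conj_ofReal]
    at h11 h01 h10 hb0
  have hee : d * cinner e e + cinner e (a0 0) * cinner (a0 0) e = 1 := by
    apply mul_left_cancel₀ (pow_ne_zero 2 hdC)
    push_cast at h11
    linear_combination h11
  have hcast (z : ℂ) : ((‖z‖ ^ 2 : ℝ) : ℂ) = z * conj z := by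
    rw [Complex.mul_conj, Complex.normSq_eq_norm_sq]
  have step0 (p : ℕ) : a0 (p + 2) = cinner (a0 (p + 1)) (a0 0) • e := by
    refine eq_smul_of_form_eq hd hee ?_ ((h0self p).trans (hcast _))
    apply mul_left_cancel₀ hdC
    linear_combination -h01 p
  have step1 (p : ℕ) : a1 (p + 1) = cinner (a1 p) (a0 0) • e := by
    refine eq_smul_of_form_eq hd hee ?_ ((h1self p).trans (hcast _))
    apply mul_left_cancel₀ hdC
    linear_combination -h10 p
  refine ⟨e, ?_, ?_, ?_, fun k => ?_, fun k => ?_⟩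
  · rw [← conj_cinner e (a0 0), ← hcast, cinner_self] at hee
    exact_mod_cast hee
  · linear_combination hbb
  · apply mul_left_cancel₀ hdC
    linear_combination -hb0
  · induction k with
    | zero => simpa using he
    | succ k ih =>
      rw [step0, ih, cinner_smul_left]
      ring_nf
  · induction k with
    | zero => simpa using step1 0
    | succ k ih =>
      rw [step1, ih, cinner_smul_left]
      ring_nf

theorem stmt8 (a0 a1 : ℕ → E2) (hA : condA a0 a1) (hC : condC a0 a1)
    (h00 : ‖a0 0‖ < 1) :
    -- Type 2
    (∃ u0 u1 : E2, ‖u0‖ = 1 ∧ ‖u1‖ = 1 ∧ cinner u0 u1 = 0 ∧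
      a0 1 = u0 ∧ (∀ k : ℕ, k ≠ 1 → a0 k = 0) ∧
      a1 0 = u1 ∧ (∀ k : ℕ, 1 ≤ k → a1 k = 0)) ∨
    -- Type 3
    (∃ u0 u1 : E2, ∃ ρ θ : ℝ, ‖u0‖ = 1 ∧ ‖u1‖ = 1 ∧ cinner u0 u1 = 0 ∧
      0 < ρ ∧ ρ < 1 ∧
      a0 0 = (ρ : ℂ) • u0 ∧
      a0 1 = ((Real.sqrt (1 - ρ ^ 2) : ℝ) : ℂ) • u1 ∧
      (∀ k : ℕ, 2 ≤ k → a0 k = 0) ∧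
      a1 0 = (Complex.exp ((θ : ℂ) * Complex.I) *
        ((Real.sqrt (1 - ρ ^ 2) : ℝ) : ℂ)) • u0 ∧
      a1 1 = (-(Complex.exp ((θ : ℂ) * Complex.I)) * (ρ : ℂ)) • u1 ∧
      (∀ k : ℕ, 2 ≤ k → a1 k = 0)) ∨
    -- Type 4
    (∃ u0 u1 : E2, ∃ ρ θ : ℝ, ‖u0‖ = 1 ∧ ‖u1‖ = 1 ∧ cinner u0 u1 = 0 ∧
      0 < ρ ∧ ρ < 1 ∧
      a0 0 = (ρ : ℂ) • u0 ∧
      (∀ k : ℕ, 1 ≤ k → a0 k =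
        (((1 - ρ ^ 2 : ℝ) : ℂ) * Complex.exp ((θ : ℂ) * Complex.I) *
          (-(ρ : ℂ) * Complex.exp ((θ : ℂ) * Complex.I)) ^ (k - 1)) • u0) ∧
      a1 0 = u1 ∧ (∀ k : ℕ, 1 ≤ k → a1 k = 0)) ∨
    -- Type 5
    (∃ u0 u1 v : E2, ∃ ρ0 ρ1 τ0 τ1 r : ℂ,
      ‖u0‖ = 1 ∧ ‖u1‖ = 1 ∧ ‖v‖ = 1 ∧ cinner v u0 ≠ 0 ∧
      ρ0 ≠ 0 ∧ ρ1 ≠ 0 ∧ τ0 ≠ 0 ∧ τ1 ≠ 0 ∧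
      0 < ‖ρ0‖ ∧ ‖ρ0‖ < 1 ∧
      ((‖ρ0‖ ^ 2 / (1 - ‖ρ0‖ ^ 2) : ℝ) : ℂ) * cinner u0 u1 * cinner v u0
        + cinner v u1 = 0 ∧
      r = -((starRingEnd ℂ) ρ0 / (starRingEnd ℂ) ρ1) * cinner v u0 /
        ((1 + ‖ρ0‖ ^ 2 / (1 - ‖ρ0‖ ^ 2) * ‖cinner v u0‖ ^ 2 : ℝ) : ℂ) ∧
      ‖ρ1‖ ^ 2 = (1 - ‖ρ0‖ ^ 2) /
        (1 + ‖ρ0‖ ^ 2 / (1 - ‖ρ0‖ ^ 2) * ‖cinner v u0‖ ^ 2) ∧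
      ‖τ0‖ ^ 2 = 1 /
        (1 + ‖ρ0‖ ^ 2 / (1 - ‖ρ0‖ ^ 2) * ‖cinner u1 u0‖ ^ 2) ∧
      τ1 = τ0 * ρ1 * cinner u1 v / (ρ0 * cinner u0 v) ∧
      a0 0 = ρ0 • u0 ∧ (∀ k : ℕ, 1 ≤ k → a0 k = (ρ1 * r ^ (k - 1)) • v) ∧
      a1 0 = τ0 • u1 ∧ (∀ k : ℕ, 1 ≤ k → a1 k = (τ1 * r ^ (k - 1)) • v)) := by
  obtain ⟨e, hee, hbb, hbe, ha0, ha1⟩ := hC.exists_geometric h00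
  have hd : 0 < 1 - ‖a0 0‖ ^ 2 := by nlinarith [norm_nonneg (a0 0)]
  have hdC : ((1 - ‖a0 0‖ ^ 2 : ℝ) : ℂ) ≠ 0 := by exact_mod_cast hd.ne'
  have he0 : e ≠ 0 := fun h => by simp [h, cinner] at hee
  have hpred (k : ℕ) (hk : 1 ≤ k) : k = k - 1 + 1 := by omega
  by_cases hw : a0 0 = 0
  · left
    have hin (x : E2) : cinner x 0 = 0 := by simp [cinner]
    simp only [hw, hin, norm_zero, ne_eq, OfNat.ofNat_ne_zero, not_false_eq_true, zero_pow,
      sub_zero, one_mul, add_zero, zero_mul, Complex.ofReal_one, zero_smul] at hee hbb hbe ha0 ha1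
    refine ⟨a0 1, a1 0, ?_, ?_, ?_, rfl, fun k hk => ?_, rfl, fun k hk => ?_⟩
    · simpa [ha0 0] using (pow_eq_one_iff_of_nonneg (norm_nonneg e) two_ne_zero).mp hee
    · exact (pow_eq_one_iff_of_nonneg (norm_nonneg (a1 0)) two_ne_zero).mp hbb
    · rw [ha0 0, cinner_smul_left, ← conj_cinner, hbe, map_zero, mul_zero]
    · rcases k with _ | _ | k
      · exact hw
      · exact absurd rfl hk
      · simp [ha0 (k + 1)]
    · rw [hpred k hk, ha1]
  have hwn : 0 < ‖a0 0‖ := norm_pos_iff.mpr hw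
  have hwC : (‖a0 0‖ : ℂ) ≠ 0 := by exact_mod_cast hwn.ne'
  by_cases hs : cinner e (a0 0) = 0
  · right; left
    have hwe : cinner (a0 0) e = 0 := by rw [← conj_cinner, hs, map_zero]
    have hbe' : cinner (a1 0) e = 0 := by
      rw [hwe, mul_zero, add_zero] at hbe
      exact (mul_eq_zero.mp hbe).resolve_left hdC
    obtain ⟨c, hc⟩ := exists_eq_smul_of_cinner_eq_zero he0 hw hbe' hwe
    have hR : 0 < √(1 - ‖a0 0‖ ^ 2) := Real.sqrt_pos.mpr hd
    have hRsq : √(1 - ‖a0 0‖ ^ 2) ^ 2 = 1 - ‖a0 0‖ ^ 2 := Real.sq_sqrt hd.le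
    have hRsqC : (√(1 - ‖a0 0‖ ^ 2) : ℂ) ^ 2 = ((1 - ‖a0 0‖ ^ 2 : ℝ) : ℂ) := by
      exact_mod_cast hRsq
    have hRC : (√(1 - ‖a0 0‖ ^ 2) : ℂ) ≠ 0 := by exact_mod_cast hR.ne'
    have hcn : (‖c‖ * ‖a0 0‖) ^ 2 = √(1 - ‖a0 0‖ ^ 2) ^ 2 := by
      rw [hc, cinner_smul_left, cinner_self, norm_mul, norm_smul, Complex.norm_real,
        Real.norm_of_nonneg (sq_nonneg _)] at hbb
      rw [hRsq]
      linear_combination hbb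
    have hcn' : ‖c‖ * ‖a0 0‖ = √(1 - ‖a0 0‖ ^ 2) :=
      (pow_left_inj₀ (by positivity) hR.le two_ne_zero).mp hcn
    obtain ⟨θ, hθ⟩ := (Complex.norm_eq_one_iff (c * ‖a0 0‖ / √(1 - ‖a0 0‖ ^ 2))).mp (by
      rw [norm_div, norm_mul, Complex.norm_real, Complex.norm_real, norm_norm,
        Real.norm_of_nonneg hR.le, hcn', div_self hR.ne'])
    refine ⟨(‖a0 0‖ : ℂ)⁻¹ • a0 0, (-(√(1 - ‖a0 0‖ ^ 2) : ℂ)) • e, ‖a0 0‖, θ,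
      norm_inv_norm_smul hw, ?_, ?_, hwn, h00, (norm_smul_inv_norm_smul hw).symm, ?_,
      fun k hk => ?_, ?_, ?_, fun k hk => ?_⟩
    · rw [norm_smul, norm_neg, Complex.norm_real, Real.norm_of_nonneg hR.le]
      refine (pow_left_inj₀ (by positivity) zero_le_one two_ne_zero).mp ?_
      rw [mul_pow, hRsq, one_pow]
      simpa [hs] using hee
    · rw [cinner_smul_left, cinner_smul_right, hwe, mul_zero, mul_zero]
    · rw [ha0 0, smul_smul, ← hRsqC]
      ring_nf
    · obtain ⟨k, rfl⟩ := Nat.exists_eq_add_of_le' hk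
      rw [show k + 2 = k + 1 + 1 from rfl, ha0, hs]
      simp
    · rw [hθ, smul_smul]
      conv_lhs => rw [hc]
      congr 1
      field_simp
    · rw [ha1 0, hθ, smul_smul, hc, cinner_smul_left, cinner_self]
      congr 1
      push_cast
      field_simp
    · obtain ⟨k, rfl⟩ := Nat.exists_eq_add_of_le' hk
      rw [show k + 2 = k + 1 + 1 from rfl, ha1, hs]
      simp
  by_cases hg : cinner (a1 0) (a0 0) = 0
  · right; right; left
    have hbn : ‖a1 0‖ = 1 := by
      refine (pow_left_inj₀ (norm_nonneg _) zero_le_one two_ne_zero).mp ?_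
      apply mul_left_cancel₀ hd.ne'
      rw [hg, norm_zero] at hbb
      linear_combination hbb
    have hb0 : a1 0 ≠ 0 := norm_ne_zero_iff.mp (by rw [hbn]; exact one_ne_zero)
    have hbe' : cinner (a1 0) e = 0 := by
      rw [hg, zero_mul, add_zero] at hbe
      exact (mul_eq_zero.mp hbe).resolve_left hdC
    have heb : cinner e (a1 0) = 0 := by rw [← conj_cinner, hbe', map_zero]
    have hwb : cinner (a0 0) (a1 0) = 0 := by rw [← conj_cinner, hg, map_zero]
    obtain ⟨c, hc⟩ := exists_eq_smul_of_cinner_eq_zero hb0 hw heb hwb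
    have hse : cinner e (a0 0) = c * ‖a0 0‖ ^ 2 := by
      rw [hc, cinner_smul_left, cinner_self, Complex.ofReal_pow]
    have hcn : (‖c‖ * ‖a0 0‖) ^ 2 = 1 ^ 2 := by
      rw [hse, hc, norm_mul, norm_smul, norm_pow, Complex.norm_real, norm_norm] at hee
      linear_combination hee
    have hcn' : ‖c‖ * ‖a0 0‖ = 1 :=
      (pow_left_inj₀ (by positivity) zero_le_one two_ne_zero).mp hcn
    obtain ⟨θ, hθ⟩ := (Complex.norm_eq_one_iff (-(c * ‖a0 0‖))).mp (by
      rw [norm_neg, norm_mul, Complex.norm_real, norm_norm, hcn'])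
    refine ⟨(‖a0 0‖ : ℂ)⁻¹ • a0 0, a1 0, ‖a0 0‖, θ, norm_inv_norm_smul hw, hbn, ?_, hwn, h00,
      (norm_smul_inv_norm_smul hw).symm, fun k hk => ?_, rfl, fun k hk => ?_⟩
    · rw [cinner_smul_left, hwb, mul_zero]
    · have hratio : -(‖a0 0‖ : ℂ) * -(c * ‖a0 0‖) = c * ‖a0 0‖ ^ 2 := by ring
      conv_lhs => rw [hpred k hk, ha0, hse, hc]
      rw [hθ, hratio, smul_smul, smul_smul]
      congr 1
      field_simp
    · rw [hpred k hk, ha1, hg, zero_mul, zero_smul]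
  right; right; right
  have hen : 0 < ‖e‖ := norm_pos_iff.mpr he0
  have heC : (‖e‖ : ℂ) ≠ 0 := by exact_mod_cast hen.ne'
  have hb0 : a1 0 ≠ 0 := fun h => hg (by simp [h, cinner])
  have hbn : 0 < ‖a1 0‖ := norm_pos_iff.mpr hb0
  have hbC : (‖a1 0‖ : ℂ) ≠ 0 := by exact_mod_cast hbn.ne'
  have hws : cinner (a0 0) e ≠ 0 := by
    rw [← conj_cinner]
    exact (map_ne_zero _).mpr hs
  have hinner (x y : E2) : cinner ((‖x‖ : ℂ)⁻¹ • x) ((‖y‖ : ℂ)⁻¹ • y)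
      = (‖x‖ : ℂ)⁻¹ * (‖y‖ : ℂ)⁻¹ * cinner x y := by
    rw [cinner_smul_left, cinner_smul_right, map_inv₀, Complex.conj_ofReal, mul_assoc]
  have hinner_norm (x y : E2) : ‖cinner ((‖x‖ : ℂ)⁻¹ • x) ((‖y‖ : ℂ)⁻¹ • y)‖
      = ‖x‖⁻¹ * ‖y‖⁻¹ * ‖cinner x y‖ := by
    rw [hinner, norm_mul, norm_mul, norm_inv, norm_inv, Complex.norm_real, Complex.norm_real,
      norm_norm, norm_norm]
  have hbe_conj : ((1 - ‖a0 0‖ ^ 2 : ℝ) : ℂ) * cinner e (a1 0)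
      + cinner (a0 0) (a1 0) * cinner e (a0 0) = 0 := by
    simpa only [map_add, map_mul, conj_cinner, Complex.conj_ofReal, map_zero]
      using congrArg conj hbe
  have hρ0 : ‖(‖a0 0‖ : ℂ)‖ = ‖a0 0‖ := by rw [Complex.norm_real, norm_norm]
  have hτ0 : ‖(‖a1 0‖ : ℂ)‖ = ‖a1 0‖ := by rw [Complex.norm_real, norm_norm]
  have hden : 1 + ‖a0 0‖ ^ 2 / (1 - ‖a0 0‖ ^ 2) * (‖e‖⁻¹ * ‖a0 0‖⁻¹ * ‖cinner e (a0 0)‖) ^ 2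
      = 1 / ((1 - ‖a0 0‖ ^ 2) * ‖e‖ ^ 2) := by
    have := hd.ne'
    field_simp
    linear_combination hee
  refine ⟨(‖a0 0‖ : ℂ)⁻¹ • a0 0, (‖a1 0‖ : ℂ)⁻¹ • a1 0, (‖e‖ : ℂ)⁻¹ • e, ‖a0 0‖,
    -((1 - ‖a0 0‖ ^ 2 : ℝ) : ℂ) * ‖e‖, ‖a1 0‖, cinner (a1 0) (a0 0) * ‖e‖, cinner e (a0 0),
    norm_inv_norm_smul hw, norm_inv_norm_smul hb0, norm_inv_norm_smul he0, ?_, hwC,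
    mul_ne_zero (neg_ne_zero.mpr hdC) heC, hbC, mul_ne_zero hg heC, by rwa [hρ0], by rwa [hρ0],
    ?_, ?_, ?_, ?_, ?_, (norm_smul_inv_norm_smul hw).symm, fun k hk => ?_,
    (norm_smul_inv_norm_smul hb0).symm, fun k hk => ?_⟩
  · rw [hinner]
    exact mul_ne_zero (mul_ne_zero (inv_ne_zero heC) (inv_ne_zero hwC)) hs
  · rw [hρ0, hinner, hinner, hinner, Complex.ofReal_div]
    field_simp
    rw [Complex.ofReal_pow]
    field_simp
    linear_combination hbe_conj
  · rw [hinner_norm, hρ0, hden, hinner]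
    simp only [map_mul, map_neg, Complex.conj_ofReal]
    rw [Complex.ofReal_div, Complex.ofReal_mul, Complex.ofReal_one, Complex.ofReal_pow]
    field_simp
  · rw [hinner_norm, hρ0, hden, norm_mul, norm_neg, Complex.norm_real, Complex.norm_real,
      Real.norm_of_nonneg hd.le, norm_norm]
    field_simp
  · rw [hinner_norm, hρ0, hτ0]
    have hne : 1 + ‖a0 0‖ ^ 2 / (1 - ‖a0 0‖ ^ 2)
        * (‖a1 0‖⁻¹ * ‖a0 0‖⁻¹ * ‖cinner (a1 0) (a0 0)‖) ^ 2 = 1 / ‖a1 0‖ ^ 2 := by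
      have := hd.ne'
      field_simp
      linear_combination hbb
    rw [hne, one_div_one_div]
  · rw [hinner, hinner]
    field_simp
    linear_combination hbe
  · conv_lhs => rw [hpred k hk, ha0]
    rw [smul_smul]
    congr 1
    field_simp
  · conv_lhs => rw [hpred k hk, ha1]
    rw [smul_smul]
    congr 1
    field_simp
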